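/- Let α > 0, let m ≥ 0 and n be integers with 0 ≤ n ≤ m, let l be an integer with 0 ≤ l ≤ n, and let t₀ ≥ 0 and T > 0. Then the antiderivatives H_ω(t) = ∫_{t₀}^{t} (αω)^{(2n+1)/(2(2m+1))} cos((2n+1−2l)ωτ) dτ converge uniformly to 0 on [t₀, t₀+T] as ω → ∞, i.e. lim_{ω→∞} sup_{t∈[t₀,t₀+T]} |H_ω(t)| = 0; the same holds with cos replaced by sin. -/

import Mathlib

open MeasureTheory Filter Topology Set

/-- If all integrals of `f` over intervals are bounded by `C`, then the antiderivatives of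
`(αω)^p f(kωτ)` with `p < 1` converge uniformly to `0` as `ω → ∞`. -/
theorem tendstoUniformlyOn_integral_rpow_mul_comp_mul {f : ℝ → ℝ} {C α k p : ℝ}
    (hf : ∀ a b : ℝ, |∫ x in a..b, f x| ≤ C) (hα : 0 < α) (hk : 0 < k) (hp : p < 1)
    (t₀ : ℝ) (s : Set ℝ) :
    TendstoUniformlyOn (fun ω t : ℝ => ∫ τ in t₀..t, (α * ω) ^ p * f (k * ω * τ)) 0 atTop s := by
  have hlim : Tendsto (fun ω : ℝ => α / k * C * (α * ω) ^ (-(1 - p))) atTop (𝓝 0) := by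
    simpa using ((tendsto_rpow_neg_atTop (sub_pos.2 hp)).comp
      (tendsto_id.const_mul_atTop hα)).const_mul (α / k * C)
  rw [Metric.tendstoUniformlyOn_iff]
  intro ε hε
  filter_upwards [hlim.eventually (gt_mem_nhds hε), eventually_gt_atTop 0] with ω hω hω₀ t _
  have hαω : 0 < α * ω := mul_pos hα hω₀
  have hkω : 0 < k * ω := mul_pos hk hω₀
  have hpow : (α * ω) ^ (-(1 - p)) = (α * ω) ^ p / (α * ω) := by
    rw [neg_sub, Real.rpow_sub_one hαω.ne']
  rw [Pi.zero_apply, dist_zero_left, Real.norm_eq_abs, intervalIntegral.integral_const_mul,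
    intervalIntegral.integral_comp_mul_left _ hkω.ne', smul_eq_mul, abs_mul, abs_mul,
    abs_of_pos (Real.rpow_pos_of_pos hαω p), abs_of_pos (inv_pos.2 hkω)]
  calc (α * ω) ^ p * ((k * ω)⁻¹ * |∫ x in k * ω * t₀..k * ω * t, f x|)
      ≤ (α * ω) ^ p * ((k * ω)⁻¹ * C) := by
        gcongr
        exact hf _ _
    _ = α / k * C * (α * ω) ^ (-(1 - p)) := by
        rw [hpow]
        field_simp
    _ < ε := hω

theorem abs_integral_cos_le_two (a b : ℝ) : |∫ x in a..b, Real.cos x| ≤ 2 := by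
  rw [integral_cos, abs_le]
  constructor <;>
    linarith [Real.sin_le_one a, Real.neg_one_le_sin a, Real.sin_le_one b, Real.neg_one_le_sin b]

theorem abs_integral_sin_le_two (a b : ℝ) : |∫ x in a..b, Real.sin x| ≤ 2 := by
  rw [integral_sin, abs_le]
  constructor <;>
    linarith [Real.cos_le_one a, Real.neg_one_le_cos a, Real.cos_le_one b, Real.neg_one_le_cos b]

/-- The antiderivatives `H_ω(t) = ∫_{t₀}^{t} (αω)^{(2n+1)/(2(2m+1))} cos((2n+1−2l)ωτ) dτ`
(and the sine variants) converge uniformly to `0` on `[t₀, t₀+T]` as `ω → ∞`. -/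
theorem antiderivative_uniform_limit_zero
    (α : ℝ) (hα : 0 < α) (m n l : ℕ) (hnm : n ≤ m) (hln : l ≤ n)
    (t₀ T : ℝ) (ht₀ : 0 ≤ t₀) (hT : 0 < T) :
    TendstoUniformlyOn
      (fun (ω : ℝ) (t : ℝ) =>
        ∫ τ in t₀..t,
          (α * ω) ^ ((2 * (n : ℝ) + 1) / (2 * (2 * (m : ℝ) + 1))) *
            Real.cos ((2 * (n : ℝ) + 1 - 2 * l) * ω * τ))
      0 atTop (Icc t₀ (t₀ + T)) ∧
    TendstoUniformlyOn
      (fun (ω : ℝ) (t : ℝ) =>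
        ∫ τ in t₀..t,
          (α * ω) ^ ((2 * (n : ℝ) + 1) / (2 * (2 * (m : ℝ) + 1))) *
            Real.sin ((2 * (n : ℝ) + 1 - 2 * l) * ω * τ))
      0 atTop (Icc t₀ (t₀ + T)) := by
  have hln' : (l : ℝ) ≤ n := by exact_mod_cast hln
  have hnm' : (n : ℝ) ≤ m := by exact_mod_cast hnm
  have hk : 0 < 2 * (n : ℝ) + 1 - 2 * l := by linarith
  have hp : (2 * (n : ℝ) + 1) / (2 * (2 * (m : ℝ) + 1)) < 1 := by
    rw [div_lt_one (by positivity)]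
    linarith [(Nat.cast_nonneg m : (0 : ℝ) ≤ m)]
  exact ⟨tendstoUniformlyOn_integral_rpow_mul_comp_mul abs_integral_cos_le_two hα hk hp _ _,
    tendstoUniformlyOn_integral_rpow_mul_comp_mul abs_integral_sin_le_two hα hk hp _ _⟩
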